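/- (One-step JAGUAR recursion) Let f : ℝ^d → ℝ and suppose: v, w ∈ ℝ^d are fixed (v = h^k - ∇f(x^k), w = g̃ - ∇f(x^{k+1}) where g̃ = Σᵢ ĝᵢ eᵢ is the full finite-difference vector), L‖x^{k+1}-x^k‖ bounds ‖∇f(x^{k+1})-∇f(x^k)‖, and h^{k+1} = h^k - ⟨h^k,e_i⟩e_i + ĝᵢ e_i with i uniform on {1,...,d} independent of everything else. Then E‖h^{k+1} - ∇f(x^{k+1})‖² ≤ (1 - 1/(2d)) ‖h^k - ∇f(x^k)‖² + 2d L² ‖x^{k+1}-x^k‖² + ‖g̃ - ∇f(x^{k+1})‖². -/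

import Mathlib

theorem jaguar_coord (d : ℕ) (h G w : EuclideanSpace ℝ (Fin d)) (g : ℝ) (i : Fin d)
    (hw : w i = g - G i) :
    ‖h - h i • EuclideanSpace.single i (1 : ℝ)
       + g • EuclideanSpace.single i (1 : ℝ) - G‖ ^ 2
      = ‖h - G‖ ^ 2 - ((h - G) i) ^ 2 + (w i) ^ 2 := by
  rw [EuclideanSpace.real_norm_sq_eq, EuclideanSpace.real_norm_sq_eq,
    ← Finset.add_sum_erase _ _ (Finset.mem_univ i),
    ← Finset.add_sum_erase (Finset.univ) (fun j => ((h - G) j) ^ 2) (Finset.mem_univ i)]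
  have : ∑ j ∈ Finset.univ.erase i, ((h - h i • EuclideanSpace.single i (1 : ℝ)
       + g • EuclideanSpace.single i (1 : ℝ) - G) j) ^ 2
      = ∑ j ∈ Finset.univ.erase i, ((h - G) j) ^ 2 := by
    refine Finset.sum_congr rfl fun j hj => ?_
    have hne : j ≠ i := Finset.ne_of_mem_erase hj
    simp [hne]
  rw [this, hw]
  simp
  ring

theorem jaguar_scalar (D A B U W : ℝ) (hD : 1 ≤ D) (hU : U ≤ (A + B) ^ 2) (hW : 0 ≤ W) :
    (1 / D) * (D * U - U + W) ≤ (1 - 1 / (2 * D)) * A ^ 2 + 2 * D * B ^ 2 + W := by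
  have hD0 : 0 < D := by linarith
  have h1 : D * U - U + W ≤ D * ((1 - 1 / (2 * D)) * A ^ 2 + 2 * D * B ^ 2 + W) := by
    have e : D * ((1 - 1 / (2 * D)) * A ^ 2 + 2 * D * B ^ 2 + W)
        = (D - 1 / 2) * A ^ 2 + 2 * D ^ 2 * B ^ 2 + D * W := by
      field_simp
    rw [e]
    have := mul_le_mul_of_nonneg_left hU (sub_nonneg.2 hD)
    have h2 := mul_nonneg (sub_nonneg.2 hD) hW
    have h3 : 0 ≤ (3 * D - 1) * B ^ 2 := mul_nonneg (by linarith) (sq_nonneg _)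
    nlinarith [sq_nonneg (A - 2 * (D - 1) * B)]
  rw [one_div, inv_mul_le_iff₀ hD0]
  exact h1

theorem jaguar_one_step (d : ℕ) (hd : 0 < d)
    (f : EuclideanSpace ℝ (Fin d) → ℝ)
    (x x' h gt : EuclideanSpace ℝ (Fin d)) (ghat : Fin d → ℝ)
    (L : ℝ) (hL : 0 ≤ L)
    (hgt : ∀ i, gt i = ghat i)
    (hgrad : ‖gradient f x' - gradient f x‖ ≤ L * ‖x' - x‖) :
    (1 / (d : ℝ)) * ∑ i : Fin d,
        ‖h - h i • EuclideanSpace.single i (1 : ℝ)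
           + ghat i • EuclideanSpace.single i (1 : ℝ) - gradient f x'‖ ^ 2 ≤
      (1 - 1 / (2 * (d : ℝ))) * ‖h - gradient f x‖ ^ 2
        + 2 * (d : ℝ) * L ^ 2 * ‖x' - x‖ ^ 2
        + ‖gt - gradient f x'‖ ^ 2 := by
  have hs : ∑ i : Fin d, ‖h - h i • EuclideanSpace.single i (1 : ℝ)
           + ghat i • EuclideanSpace.single i (1 : ℝ) - gradient f x'‖ ^ 2
      = d * ‖h - gradient f x'‖ ^ 2 - ‖h - gradient f x'‖ ^ 2
        + ‖gt - gradient f x'‖ ^ 2 := by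
    rw [Finset.sum_congr rfl fun i _ => jaguar_coord d h (gradient f x') (gt - gradient f x')
      (ghat i) i (by simp [hgt])]
    rw [Finset.sum_add_distrib, Finset.sum_sub_distrib, ← EuclideanSpace.real_norm_sq_eq,
      ← EuclideanSpace.real_norm_sq_eq]
    simp
  rw [hs]
  have hU : ‖h - gradient f x'‖ ^ 2 ≤ (‖h - gradient f x‖ + L * ‖x' - x‖) ^ 2 := by
    have : ‖h - gradient f x'‖ ≤ ‖h - gradient f x‖ + ‖gradient f x' - gradient f x‖ := by
      have := norm_sub_le (h - gradient f x) (gradient f x' - gradient f x)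
      simpa using this
    gcongr
    linarith
  have := jaguar_scalar d _ _ _ _ (by exact_mod_cast hd) hU
    (sq_nonneg ‖gt - gradient f x'‖)
  rw [mul_pow, ← mul_assoc] at this
  exact this
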